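/- arXiv:2402.17865 — 4 statements merged into one kernel-verified Lean document; each statement's English description precedes it below -/
import Mathlib

section
/- For every a ∈ ℂ^p, the deformed Tanisaki–Garsia–Procesi algebra R_a(λ) is finite dimensional over ℂ, with dim_ℂ R_a(λ) ≤ d!. -/
open MvPolynomial

noncomputable section

/-- Complete homogeneous symmetric function `h_k` of a list of complex numbers. -/
def hcomp : ℕ → List ℂ → ℂ
  | 0, _ => 1
  | _ + 1, [] => 0
  | k + 1, x :: l => x * hcomp k (x :: l) + hcomp (k + 1) l
  termination_by k l => (l.length, k)

/-- Elementary symmetric polynomial `e_r` in the variables indexed by `J ⊆ {1,…,d}`. -/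
def elemSym (d : ℕ) (J : Finset (Fin d)) (r : ℕ) : MvPolynomial (Fin d) ℂ :=
  ∑ s ∈ J.powersetCard r, ∏ j ∈ s, X j

/-- The tuple `a^{(n)}` : entries `a_1,…,a_{λ_i}` for each row `i = n+1,…,ℓ` (0-indexed rows). -/
def aTuple (ℓ : ℕ) (lam : ℕ → ℕ) (a : ℕ → ℂ) (n : ℕ) : List ℂ :=
  ((List.range ℓ).drop n).flatMap fun i => (List.range (lam i)).map a

/-- `m_λ(n) = λ_{n+1} + … + λ_ℓ` (0-indexed rows `n,…,ℓ-1`). -/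
def mRem (ℓ : ℕ) (lam : ℕ → ℕ) (n : ℕ) : ℕ := ∑ i ∈ Finset.Ico n ℓ, lam i

/-- The deformed Tanisaki generator `g_{n,J,r} = Σ_{k=0}^r (−1)^k e_{r−k}(t_J) h_k(a^{(n)})`. -/
def tanGen (d ℓ : ℕ) (lam : ℕ → ℕ) (a : ℕ → ℂ) (n : ℕ) (J : Finset (Fin d)) (r : ℕ) :
    MvPolynomial (Fin d) ℂ :=
  ∑ k ∈ Finset.range (r + 1), C ((-1) ^ k * hcomp k (aTuple ℓ lam a n)) * elemSym d J (r - k)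

/-- The deformed Tanisaki ideal `⟨𝒞^a_λ⟩`. -/
def tanIdeal (d ℓ : ℕ) (lam : ℕ → ℕ) (a : ℕ → ℂ) : Ideal (MvPolynomial (Fin d) ℂ) :=
  Ideal.span {g | ∃ n J r, n < ℓ ∧ J.card = d - n ∧
    d - n - mRem ℓ lam n < r ∧ r ≤ d - n ∧ g = tanGen d ℓ lam a n J r}

/-- `lam 0, lam 1, …, lam (ℓ-1)` is a partition of `d` with `ℓ` positive parts. -/
def IsPartitionOf (d ℓ : ℕ) (lam : ℕ → ℕ) : Prop :=
  0 < ℓ ∧ (∀ i j, i ≤ j → lam j ≤ lam i) ∧ (∀ i < ℓ, 0 < lam i) ∧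
    (∀ i, ℓ ≤ i → lam i = 0) ∧ ∑ i ∈ Finset.range ℓ, lam i = d

/-- `λ^t_i = #{rows j with λ_j ≥ i}` (here `i ≥ 1`). -/
def lamT (ℓ : ℕ) (lam : ℕ → ℕ) (i : ℕ) : ℕ :=
  ((Finset.range ℓ).filter fun j => i ≤ lam j).card

/-- The deformed Tanisaki–Garsia–Procesi algebra `R_a(λ)`. -/
abbrev TGPAlg (d ℓ : ℕ) (lam : ℕ → ℕ) (a : ℕ → ℂ) :=
  MvPolynomial (Fin d) ℂ ⧸ tanIdeal d ℓ lam a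


open Polynomial in
theorem span_card_aux (n : ℕ) : ∀ (B A : Type) [CommRing B] [CommRing A] [Algebra B A]
    (f : B[X]) (x : Fin n → A), f.Monic → f.natDegree ≤ n →
    f.map (algebraMap B A) = ∏ i, (Polynomial.X - Polynomial.C (x i)) →
    Algebra.adjoin B (Set.range x) = ⊤ →
    ∃ s : Finset A, s.card ≤ n.factorial ∧ Submodule.span B (s : Set A) = ⊤ := by
  classical
  induction n with
  | zero =>
    intro B A _ _ _ f x _ _ _ hx
    refine ⟨{1}, by simp, ?_⟩
    have h0 : Set.range x = ∅ := Set.range_eq_empty x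
    rw [h0, Algebra.adjoin_empty] at hx
    have := congrArg Subalgebra.toSubmodule hx
    rw [Algebra.toSubmodule_bot, Algebra.top_toSubmodule] at this
    rw [Finset.coe_singleton, ← Submodule.one_eq_span]
    exact this
  | succ n ih =>
    intro B A _ _ _ f x hf hdeg hprod hx
    have hroot : Polynomial.eval₂ (algebraMap B A) (x 0) f = 0 := by
      rw [← Polynomial.eval_map, hprod, Polynomial.eval_prod]
      exact Finset.prod_eq_zero (Finset.mem_univ 0) (by simp)
    letI : Algebra (AdjoinRoot f) A := (AdjoinRoot.lift (algebraMap B A) (x 0) hroot).toAlgebra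
    have hmap : algebraMap (AdjoinRoot f) A = AdjoinRoot.lift (algebraMap B A) (x 0) hroot := rfl
    haveI : IsScalarTower B (AdjoinRoot f) A := IsScalarTower.of_algebraMap_eq (fun b => by
      rw [hmap, AdjoinRoot.algebraMap_eq, AdjoinRoot.lift_of])
    have hr0 : algebraMap (AdjoinRoot f) A (AdjoinRoot.root f) = x 0 := by
      rw [hmap, AdjoinRoot.lift_root]
    set F : (AdjoinRoot f)[X] := f.map (algebraMap B (AdjoinRoot f)) with hF
    have hFr : F.IsRoot (AdjoinRoot.root f) := AdjoinRoot.isRoot_root f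
    set q := F /ₘ (Polynomial.X - Polynomial.C (AdjoinRoot.root f)) with hq
    have hmul : (Polynomial.X - Polynomial.C (AdjoinRoot.root f)) * q = F :=
      Polynomial.mul_divByMonic_eq_iff_isRoot.2 hFr
    have hFm : F.Monic := hf.map _
    have hqm : q.Monic := by
      apply Polynomial.Monic.of_mul_monic_left (Polynomial.monic_X_sub_C (AdjoinRoot.root f))
      rw [hmul]; exact hFm
    have hqd : q.natDegree ≤ n := by
      rcases subsingleton_or_nontrivial (AdjoinRoot f) with h | h
      · rw [Polynomial.natDegree_of_subsingleton]; exact Nat.zero_le _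
      · rw [hq, Polynomial.natDegree_divByMonic _ (Polynomial.monic_X_sub_C _),
          Polynomial.natDegree_X_sub_C]
        have : F.natDegree ≤ f.natDegree := Polynomial.natDegree_map_le
        omega
    have hqp : q.map (algebraMap (AdjoinRoot f) A)
        = ∏ i : Fin n, (Polynomial.X - Polynomial.C (x i.succ)) := by
      have h1 := congrArg (Polynomial.map (algebraMap (AdjoinRoot f) A)) hmul
      rw [Polynomial.map_mul, Polynomial.map_sub, Polynomial.map_X, Polynomial.map_C, hr0,
        hF, Polynomial.map_map, ← IsScalarTower.algebraMap_eq, hprod, Fin.prod_univ_succ] at h1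
      exact (Polynomial.monic_X_sub_C (x 0)).isRegular.left h1
    have hadj : Algebra.adjoin (AdjoinRoot f) (Set.range fun i : Fin n => x i.succ) = ⊤ := by
      rw [eq_top_iff]
      intro y _
      have hy : y ∈ Algebra.adjoin B (Set.range x) := by rw [hx]; trivial
      have hle : Algebra.adjoin B (Set.range x) ≤
          (Algebra.adjoin (AdjoinRoot f)
            (Set.range fun i : Fin n => x i.succ)).restrictScalars B := by
        apply Algebra.adjoin_le
        rintro _ ⟨i, rfl⟩
        rw [SetLike.mem_coe, Subalgebra.mem_restrictScalars]
        refine Fin.cases ?_ (fun j => ?_) i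
        · rw [← hr0]
          exact Subalgebra.algebraMap_mem
            (Algebra.adjoin (AdjoinRoot f) (Set.range fun i : Fin n => x i.succ)) _
        · have hj : x j.succ ∈ Set.range fun i : Fin n => x i.succ := Set.mem_range_self j
          exact Algebra.subset_adjoin hj
      exact hle hy
    obtain ⟨t, htc, hts⟩ := ih (AdjoinRoot f) A q (fun i => x i.succ) hqm hqd hqp hadj
    let pb := AdjoinRoot.powerBasis' hf
    let s : Finset (AdjoinRoot f) := Finset.univ.image pb.basis
    have hsc : s.card ≤ n + 1 := by
      refine Finset.card_image_le.trans ?_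
      rw [Finset.card_univ, Fintype.card_fin]
      exact hdeg
    have hss : Submodule.span B (s : Set (AdjoinRoot f)) = ⊤ := by
      have : (s : Set (AdjoinRoot f)) = Set.range pb.basis := by simp [s]
      rw [this]; exact pb.basis.span_eq
    refine ⟨Finset.image₂ (· • ·) s t, ?_, ?_⟩
    · refine (Finset.card_image₂_le _ _ _).trans ?_
      rw [Nat.factorial_succ]
      exact Nat.mul_le_mul hsc htc
    · have h2 := Submodule.span_smul_of_span_eq_top hss (t : Set A)
      rw [hts] at h2
      rw [Finset.coe_image₂]
      exact h2.trans (Submodule.restrictScalars_top _ _ _)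

theorem elemSym_const (d ℓ : ℕ) (lam : ℕ → ℕ)
    (hpart : IsPartitionOf d ℓ lam) (a : ℕ → ℂ) (r : ℕ) (hr : r ≤ d) :
    ∃ c : ℂ, Ideal.Quotient.mk (tanIdeal d ℓ lam a) (elemSym d Finset.univ r)
      = algebraMap ℂ (TGPAlg d ℓ lam a) c := by
  have hC : ∀ c : ℂ, Ideal.Quotient.mk (tanIdeal d ℓ lam a) (C c)
      = algebraMap ℂ (TGPAlg d ℓ lam a) c := fun c => rfl
  induction r using Nat.strong_induction_on with
  | _ r ih =>
    rcases Nat.eq_zero_or_pos r with rfl | hpos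
    · exact ⟨1, by simp [elemSym]⟩
    · have hm : mRem ℓ lam 0 = d := by
        rw [mRem, ← Finset.range_eq_Ico]; exact hpart.2.2.2.2
      have hmem : tanGen d ℓ lam a 0 Finset.univ r ∈ tanIdeal d ℓ lam a :=
        Ideal.subset_span ⟨0, Finset.univ, r, hpart.1, by simp, by omega, by omega, rfl⟩
      have h0 := Ideal.Quotient.eq_zero_iff_mem.2 hmem
      rw [tanGen, Finset.sum_range_succ', map_add, map_sum] at h0
      have hex : ∀ k ∈ Finset.range r, ∃ c : ℂ, Ideal.Quotient.mk (tanIdeal d ℓ lam a)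
          (C ((-1) ^ (k + 1) * hcomp (k + 1) (aTuple ℓ lam a 0))
            * elemSym d Finset.univ (r - (k + 1))) = algebraMap ℂ (TGPAlg d ℓ lam a) c := by
        intro k hk
        obtain ⟨c, hc⟩ := ih (r - (k + 1)) (by omega) (by omega)
        exact ⟨_ * c, by rw [map_mul, hc, hC, ← map_mul]⟩
      choose! c hc using hex
      rw [Finset.sum_congr rfl hc, ← map_sum] at h0
      refine ⟨-∑ k ∈ Finset.range r, c k, ?_⟩
      rw [map_neg, eq_neg_iff_add_eq_zero, add_comm, ← h0]
      simp [hcomp]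

/-- `R_a(λ)` is finite dimensional over `ℂ` with `dim_ℂ R_a(λ) ≤ d!`. -/
theorem deformed_TGP_finiteDimensional (d ℓ : ℕ) (lam : ℕ → ℕ)
    (hpart : IsPartitionOf d ℓ lam) (a : ℕ → ℂ) :
    FiniteDimensional ℂ (TGPAlg d ℓ lam a) ∧
    Module.finrank ℂ (TGPAlg d ℓ lam a) ≤ Nat.factorial d := by
  classical
  let π := Ideal.Quotient.mk (tanIdeal d ℓ lam a)
  let x : Fin d → TGPAlg d ℓ lam a := fun i => π (X i)
  have hcoef : ∀ r, ∃ c : ℂ, r ≤ d →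
      (Finset.univ.val.map x).esymm r = algebraMap ℂ (TGPAlg d ℓ lam a) c := by
    intro r
    by_cases hr : r ≤ d
    · obtain ⟨c, hc⟩ := elemSym_const d ℓ lam hpart a r hr
      refine ⟨c, fun _ => ?_⟩
      rw [← hc, Finset.esymm_map_val, elemSym, map_sum]
      exact Finset.sum_congr rfl fun s _ => (map_prod π _ _).symm
    · exact ⟨0, fun h => absurd h hr⟩
  choose c hc using hcoef
  let f : Polynomial ℂ := ∑ j ∈ Finset.range (d + 1),
    (-1) ^ j * (Polynomial.C (c j) * Polynomial.X ^ (d - j))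
  have hfmap : f.map (algebraMap ℂ (TGPAlg d ℓ lam a))
      = ∏ i, (Polynomial.X - Polynomial.C (x i)) := by
    have h := Multiset.prod_X_sub_X_eq_sum_esymm (Finset.univ.val.map x)
    rw [Multiset.map_map] at h
    have hcard : (Finset.univ.val.map x).card = d := by simp
    rw [hcard] at h
    refine Eq.trans ?_ h.symm
    rw [Polynomial.map_sum]
    refine Finset.sum_congr rfl fun j hj => ?_
    rw [hc j (by have := Finset.mem_range.1 hj; omega)]
    simp
  have hadj : Algebra.adjoin ℂ (Set.range x) = ⊤ := by
    have hr : Set.range x = (Ideal.Quotient.mkₐ ℂ (tanIdeal d ℓ lam a)) ''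
        Set.range (X : Fin d → MvPolynomial (Fin d) ℂ) := by
      rw [← Set.range_comp]; rfl
    rw [hr, Algebra.adjoin_image, MvPolynomial.adjoin_range_X, Algebra.map_top,
      AlgHom.range_eq_top]
    exact Ideal.Quotient.mkₐ_surjective _ _
  have key : ∃ s : Finset (TGPAlg d ℓ lam a), s.card ≤ d.factorial ∧
      Submodule.span ℂ (s : Set (TGPAlg d ℓ lam a)) = ⊤ := by
    rcases subsingleton_or_nontrivial (TGPAlg d ℓ lam a) with hs | hs
    · exact ⟨∅, by simp, Subsingleton.elim _ _⟩
    · have hinj : Function.Injective (algebraMap ℂ (TGPAlg d ℓ lam a)) :=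
        (algebraMap ℂ (TGPAlg d ℓ lam a)).injective
      refine span_card_aux d ℂ _ f x ?_ ?_ hfmap hadj
      · apply Polynomial.monic_of_injective hinj
        rw [hfmap]
        exact Polynomial.monic_prod_of_monic _ _ fun i _ => Polynomial.monic_X_sub_C _
      · rw [← Polynomial.natDegree_map_eq_of_injective hinj, hfmap,
          Polynomial.natDegree_prod_of_monic _ _ fun i _ => Polynomial.monic_X_sub_C _]
        simp
  obtain ⟨s, hs, hspan⟩ := key
  refine ⟨⟨⟨s, hspan⟩⟩, ?_⟩
  have h := finrank_span_finset_le_card (R := ℂ) s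
  rw [Set.finrank, hspan, finrank_top] at h
  exact h.trans hs

end
end

section
/- For each 1 ≤ i ≤ d, the polynomial ∏_{j=1}^{d} (t_i − a^{(0)}_j) lies in the deformed Tanisaki ideal ⟨𝒞^a_λ⟩. -/
open MvPolynomial

noncomputable section

/-- Generating series of elementary symmetric functions. -/
def eSer {Q : Type*} [CommRing Q] (s : Multiset Q) : PowerSeries Q :=
  PowerSeries.mk fun k => s.esymm k

/-- Signed generating series of complete homogeneous symmetric functions. -/
def hSer {Q : Type*} [CommRing Q] (f : ℂ →+* Q) (l : List ℂ) : PowerSeries Q :=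
  PowerSeries.mk fun k => f ((-1) ^ k * hcomp k l)

lemma eSer_cons {Q : Type*} [CommRing Q] (x : Q) (s : Multiset Q) :
    eSer (x ::ₘ s) = eSer s * (1 + PowerSeries.C x * PowerSeries.X) := by
  ext k
  rw [mul_add, mul_one, ← mul_assoc]
  cases k with
  | zero => simp [eSer, Multiset.esymm]
  | succ k =>
    rw [map_add, PowerSeries.coeff_succ_mul_X, PowerSeries.coeff_mul_C]
    simp only [eSer, PowerSeries.coeff_mk, Multiset.esymm, Multiset.powersetCard_cons,
      Multiset.map_add, Multiset.sum_add, Multiset.map_map]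
    congr 1
    rw [mul_comm, ← Multiset.sum_map_mul_left]
    simp

lemma hSer_cons {Q : Type*} [CommRing Q] (f : ℂ →+* Q) (x : ℂ) (l : List ℂ) :
    (1 + PowerSeries.C (f x) * PowerSeries.X) * hSer f (x :: l) = hSer f l := by
  ext k
  rw [add_mul, one_mul, mul_assoc]
  cases k with
  | zero => simp [hSer, hcomp]
  | succ k =>
    rw [map_add, PowerSeries.coeff_C_mul, PowerSeries.coeff_succ_X_mul]
    simp only [hSer, PowerSeries.coeff_mk]
    rw [← map_mul, ← map_add]
    congr 1
    rw [hcomp]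
    ring

lemma hSer_nil {Q : Type*} [CommRing Q] (f : ℂ →+* Q) : hSer f [] = 1 := by
  ext k
  cases k with
  | zero => simp [hSer, hcomp]
  | succ k => simp [hSer, hcomp, PowerSeries.coeff_one]

lemma eSer_zero {Q : Type*} [CommRing Q] : eSer (0 : Multiset Q) = 1 := by
  ext k
  cases k with
  | zero => simp [eSer, Multiset.esymm]
  | succ k => simp [eSer, Multiset.esymm, PowerSeries.coeff_one, Multiset.powersetCard_zero_right]

lemma eSer_mul_hSer {Q : Type*} [CommRing Q] (f : ℂ →+* Q) (l : List ℂ) :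
    eSer ((l.map f : List Q) : Multiset Q) * hSer f l = 1 := by
  induction l with
  | nil => rw [hSer_nil, mul_one]; exact eSer_zero
  | cons x l ih =>
    rw [List.map_cons, ← Multiset.cons_coe, eSer_cons, mul_assoc, hSer_cons, ih]

/-- If `E(s) H(l) = 1` modulo degree `> d`, then the elementary symmetric functions agree. -/
lemma esymm_eq_of {Q : Type*} [CommRing Q] (f : ℂ →+* Q) (l : List ℂ) (s : Multiset Q) (d : ℕ)
    (h : ∀ r, 0 < r → r ≤ d → PowerSeries.coeff r (hSer f l * eSer s) = 0) (r : ℕ) (hr : r ≤ d) :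
    s.esymm r = Multiset.esymm ((l.map f : List Q) : Multiset Q) r := by
  have h1 : (PowerSeries.X : PowerSeries Q) ^ (d + 1) ∣ hSer f l * eSer s - 1 := by
    rw [PowerSeries.X_pow_dvd_iff]
    intro m hm
    rcases Nat.eq_zero_or_pos m with rfl | hm0
    · simp [hSer, eSer, hcomp, Multiset.esymm]
    · rw [map_sub, h m hm0 (by omega), PowerSeries.coeff_one, if_neg (by omega), sub_zero]
  have h2 := h1.mul_left (eSer ((l.map f : List Q) : Multiset Q))
  rw [mul_sub, ← mul_assoc, eSer_mul_hSer, one_mul, mul_one, PowerSeries.X_pow_dvd_iff] at h2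
  have h3 := h2 r (by omega)
  rw [map_sub, sub_eq_zero] at h3
  simpa [eSer] using h3

lemma prod_sub_eq_of_esymm {Q : Type*} [CommRing Q] (s t : Multiset Q)
    (hc : Multiset.card s = Multiset.card t)
    (h : ∀ r ≤ Multiset.card s, s.esymm r = t.esymm r) (x : Q) :
    (s.map fun y => x - y).prod = (t.map fun y => x - y).prod := by
  have key : (s.map fun y => Polynomial.X - Polynomial.C y).prod =
      (t.map fun y => Polynomial.X - Polynomial.C y).prod := by
    rw [Multiset.prod_X_sub_X_eq_sum_esymm, Multiset.prod_X_sub_X_eq_sum_esymm, ← hc]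
    refine Finset.sum_congr rfl fun j hj => ?_
    rw [h j (by simpa [Nat.lt_succ_iff] using hj)]
  have := congrArg (Polynomial.eval x) key
  simpa [Polynomial.eval_multiset_prod, Multiset.map_map] using this

lemma aTuple_length (ℓ : ℕ) (lam : ℕ → ℕ) (a : ℕ → ℂ) :
    (aTuple ℓ lam a 0).length = ∑ i ∈ Finset.range ℓ, lam i := by
  simp only [aTuple, List.drop_zero, List.length_flatMap, List.length_map, List.length_range]
  rfl

lemma prod_range_getD {Q : Type*} [CommMonoid Q] (g : ℂ → Q) (l : List ℂ) :
    ∏ j ∈ Finset.range l.length, g (l.getD j 0) = (l.map g).prod := by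
  induction l with
  | nil => simp
  | cons x l ih => rw [List.length_cons, Finset.prod_range_succ', mul_comm]; simp [← ih]

/-- for each `1 ≤ i ≤ d`, the polynomial `∏_{j=1}^d (t_i − a^{(0)}_j)` lies in
the deformed Tanisaki ideal. -/
theorem deformed_TGP_variable_relation (d ℓ : ℕ) (lam : ℕ → ℕ)
    (hpart : IsPartitionOf d ℓ lam) (a : ℕ → ℂ) (i : Fin d) :
    (∏ j ∈ Finset.range d, (X i - C ((aTuple ℓ lam a 0).getD j 0))) ∈
      tanIdeal d ℓ lam a := by
  obtain ⟨hl, -, -, -, hsum⟩ := hpart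
  set l := aTuple ℓ lam a 0 with hldef
  have hlen : l.length = d := (aTuple_length ℓ lam a).trans hsum
  set π := Ideal.Quotient.mk (tanIdeal d ℓ lam a) with hπ
  let f : ℂ →+* TGPAlg d ℓ lam a := π.comp C
  let s : Multiset (TGPAlg d ℓ lam a) :=
    (Finset.univ : Finset (Fin d)).val.map fun j => π (X j)
  have hm : mRem ℓ lam 0 = d := by rw [mRem, ← hsum, Finset.range_eq_Ico]
  have hcoef : ∀ r, 0 < r → r ≤ d → PowerSeries.coeff r (hSer f l * eSer s) = 0 := by
    intro r hr0 hr
    have hg : π (tanGen d ℓ lam a 0 Finset.univ r) = 0 := by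
      rw [hπ, Ideal.Quotient.eq_zero_iff_mem]
      exact Ideal.subset_span ⟨0, Finset.univ, r, hl, by simp, by omega, by omega, rfl⟩
    rw [PowerSeries.coeff_mul, Finset.Nat.sum_antidiagonal_eq_sum_range_succ_mk, ← hg, tanGen,
      map_sum]
    refine Finset.sum_congr rfl fun k _ => ?_
    rw [map_mul]
    simp only [hSer, eSer, PowerSeries.coeff_mk]
    congr 1
    rw [elemSym, map_sum, Finset.esymm_map_val]
    exact Finset.sum_congr rfl fun t _ => (map_prod π _ _).symm
  have hes := esymm_eq_of f l s d hcoef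
  have hcs : Multiset.card s = d := by simp [s]
  have hprod := prod_sub_eq_of_esymm s ((l.map f : List _) : Multiset _)
    (by rw [hcs]; simp [hlen]) (by rw [hcs]; exact hes) (π (X i))
  have hzero : (s.map fun y => π (X i) - y).prod = 0 := by
    apply Multiset.prod_eq_zero
    rw [Multiset.mem_map]
    exact ⟨π (X i), Multiset.mem_map.2 ⟨i, Finset.mem_univ i, rfl⟩, sub_self _⟩
  rw [hzero] at hprod
  rw [← Ideal.Quotient.eq_zero_iff_mem, ← hπ, map_prod]
  simp only [map_sub]
  have hg := prod_range_getD (fun z => π (X i) - π (C z)) l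
  rw [hlen] at hg
  rw [hg, hprod]
  simp [f, Function.comp_def]

end
end

section
/- Let b, c ∈ ℂ with b ≠ 0, and let ã = (b·a_1 + c, …, b·a_p + c). The ℂ-algebra automorphism φ of ℂ[t_1, …, t_d] determined by φ(t_k) = b·t_k + c for all k maps the ideal ⟨𝒞^ã_λ⟩ onto the ideal ⟨𝒞^a_λ⟩; consequently φ induces an isomorphism of ℂ-algebras R_ã(λ) ≅ R_a(λ). -/
open MvPolynomial

noncomputable section

/-- Multiplication of a sequence (thought of as a power series) by `1 + t z`. -/
def opSeq {R : Type*} [CommRing R] (t : R) (F : ℕ → R) : ℕ → R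
  | 0 => F 0
  | r + 1 => F (r + 1) + t * F r

/-- The substitution `F(z) ↦ (1 + c z)^k F(b z / (1 + c z))` on sequences. -/
def PhiSeq {R : Type*} [CommRing R] (b c : R) (k : ℤ) (F : ℕ → R) (r : ℕ) : R :=
  ∑ s ∈ Finset.range (r + 1),
    b ^ s * c ^ (r - s) * ((Ring.choose (k - s) (r - s) : ℤ) : R) * F s

lemma opSeq_injective {R : Type*} [CommRing R] (t : R) {F G : ℕ → R}
    (h : opSeq t F = opSeq t G) : F = G := by
  funext r
  induction r with
  | zero => exact congrFun h 0
  | succ r ih =>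
    have := congrFun h (r + 1)
    simp only [opSeq, ih] at this
    exact add_right_cancel this

lemma PhiSeq_opSeq {R : Type*} [CommRing R] (b c t : R) (k : ℤ) (F : ℕ → R) :
    PhiSeq b c (k + 1) (opSeq t F) = opSeq (b * t + c) (PhiSeq b c k F) := by
  funext r
  cases r with
  | zero => simp [PhiSeq, opSeq]
  | succ r =>
    have h1 : PhiSeq b c (k + 1) (opSeq t F) (r + 1) =
        PhiSeq b c (k + 1) F (r + 1) + b * t * PhiSeq b c k F r := by
      simp only [PhiSeq]
      rw [Finset.sum_range_succ', Finset.sum_range_succ' _ (r + 1), Finset.mul_sum,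
        add_right_comm, ← Finset.sum_add_distrib]
      congr 1
      refine Finset.sum_congr rfl fun s _ => ?_
      have e1 : k + 1 - ((s + 1 : ℕ) : ℤ) = k - s := by push_cast; ring
      have e2 : r + 1 - (s + 1) = r - s := by omega
      rw [e1, e2]
      simp only [opSeq]
      ring
    have h2 : PhiSeq b c (k + 1) F (r + 1) =
        PhiSeq b c k F (r + 1) + c * PhiSeq b c k F r := by
      simp only [PhiSeq]
      rw [Finset.sum_range_succ, Finset.sum_range_succ _ (r + 1), Finset.mul_sum,
        add_right_comm, ← Finset.sum_add_distrib]
      congr 1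
      · refine Finset.sum_congr rfl fun s hs => ?_
        have hs' : s ≤ r := by simpa [Nat.lt_succ_iff] using hs
        have e1 : k + 1 - (s : ℤ) = (k - s) + 1 := by ring
        have e2 : r + 1 - s = (r - s) + 1 := by omega
        rw [e1, e2, Ring.choose_succ_succ]
        push_cast
        ring
      · simp
    rw [h1, h2]
    simp only [opSeq]
    ring

/-- The sequence `r ↦ g_r`. -/
def gSeq (d : ℕ) (J : Finset (Fin d)) (L : List ℂ) (r : ℕ) : MvPolynomial (Fin d) ℂ :=
  ∑ k ∈ Finset.range (r + 1), C ((-1) ^ k * hcomp k L) * elemSym d J (r - k)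

lemma hcomp_zero (L : List ℂ) : hcomp 0 L = 1 := by
  cases L <;> simp [hcomp]

lemma gSeq_nil (d : ℕ) (J : Finset (Fin d)) : gSeq d J [] = elemSym d J := by
  funext r
  unfold gSeq
  rw [Finset.sum_range_succ']
  simp [hcomp]

lemma gSeq_cons (d : ℕ) (J : Finset (Fin d)) (x : ℂ) (L : List ℂ) :
    opSeq (C x) (gSeq d J (x :: L)) = gSeq d J L := by
  funext r
  cases r with
  | zero => simp [opSeq, gSeq, hcomp_zero]
  | succ r =>
    simp only [opSeq, gSeq]
    rw [Finset.sum_range_succ', Finset.sum_range_succ' _ (r + 1), Finset.mul_sum,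
        add_right_comm, ← Finset.sum_add_distrib]
    congr 1
    · refine Finset.sum_congr rfl fun s _ => ?_
      have e2 : r + 1 - (s + 1) = r - s := by omega
      rw [e2, hcomp]
      simp only [map_mul, map_add, map_pow, map_neg, map_one]
      ring
    · simp [hcomp_zero]

lemma elemSym_insert (d : ℕ) (J : Finset (Fin d)) (j : Fin d) (hj : j ∉ J) :
    elemSym d (insert j J) = opSeq (X j) (elemSym d J) := by
  funext r
  cases r with
  | zero => simp [elemSym, opSeq]
  | succ r =>
    simp only [elemSym, opSeq]
    rw [Finset.powersetCard_succ_insert hj, Finset.sum_union, Finset.sum_image, Finset.mul_sum]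
    · congr 1
      refine Finset.sum_congr rfl fun s hs => ?_
      rw [Finset.prod_insert]
      exact fun h => hj ((Finset.mem_powersetCard.1 hs).1 h)
    · intro s hs t ht h
      have hs' : j ∉ s := fun h => hj ((Finset.mem_powersetCard.1 hs).1 h)
      have ht' : j ∉ t := fun h => hj ((Finset.mem_powersetCard.1 ht).1 h)
      rw [← Finset.erase_insert hs', ← Finset.erase_insert ht', h]
    · rw [Finset.disjoint_left]
      intro s hs hs2
      obtain ⟨t, _, rfl⟩ := Finset.mem_image.1 hs2
      exact hj ((Finset.mem_powersetCard.1 hs).1 (Finset.mem_insert_self _ _))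

lemma map_opSeq {R S : Type*} [CommRing R] [CommRing S] (f : R →+* S) (t : R) (F : ℕ → R) :
    (fun r => f (opSeq t F r)) = opSeq (f t) (fun r => f (F r)) := by
  funext r
  cases r <;> simp [opSeq]

/-- The substitution `t_k ↦ b t_k + c`. -/
abbrev phiAff (d : ℕ) (b c : ℂ) : MvPolynomial (Fin d) ℂ →ₐ[ℂ] MvPolynomial (Fin d) ℂ :=
  aeval (fun k : Fin d => C b * X k + C c)

lemma phi_elemSym (d : ℕ) (b c : ℂ) (J : Finset (Fin d)) :
    (fun r => phiAff d b c (elemSym d J r)) = PhiSeq (C b) (C c) J.card (elemSym d J) := by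
  induction J using Finset.induction_on with
  | empty =>
    funext r
    have h0 : ∀ r, elemSym d ∅ (r + 1) = 0 := by
      intro r
      unfold elemSym
      rw [Finset.powersetCard_eq_empty.2 (by simp)]
      simp
    cases r with
    | zero => simp [PhiSeq, elemSym]
    | succ r =>
      unfold PhiSeq
      rw [Finset.sum_range_succ', h0]
      simp [h0]
  | insert j J hj ih =>
    rw [elemSym_insert d J j hj, Finset.card_insert_of_notMem hj]
    push_cast
    rw [PhiSeq_opSeq, ← ih]
    have := map_opSeq (phiAff d b c : MvPolynomial (Fin d) ℂ →+* MvPolynomial (Fin d) ℂ)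
      (X j) (elemSym d J)
    simpa using this

lemma phi_gSeq (d : ℕ) (b c : ℂ) (J : Finset (Fin d)) (L : List ℂ) :
    (fun r => phiAff d b c (gSeq d J (L.map fun x => b * x + c) r)) =
      PhiSeq (C b) (C c) (J.card - L.length) (gSeq d J L) := by
  induction L with
  | nil =>
    have := phi_elemSym d b c J
    simpa [gSeq_nil] using this
  | cons x L ih =>
    apply opSeq_injective (C b * C x + C c)
    rw [← PhiSeq_opSeq, gSeq_cons]
    have e : ((J.card : ℤ) - ((x :: L).length : ℤ) + 1) = J.card - L.length := by
      simp only [List.length_cons]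
      push_cast
      ring
    rw [e, ← ih, List.map_cons, ← gSeq_cons d J (b * x + c) (L.map fun x => b * x + c)]
    have := map_opSeq (phiAff d b c : MvPolynomial (Fin d) ℂ →+* MvPolynomial (Fin d) ℂ)
      (C (b * x + c)) (gSeq d J ((b * x + c) :: L.map fun x => b * x + c))
    simp only [RingHom.coe_coe] at this
    rw [this]
    congr 1
    simp [MvPolynomial.algebraMap_eq]

lemma aTuple_aff (ℓ : ℕ) (lam : ℕ → ℕ) (a : ℕ → ℂ) (b c : ℂ) (n : ℕ) :
    aTuple ℓ lam (fun j => b * a j + c) n = (aTuple ℓ lam a n).map fun x => b * x + c := by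
  simp [aTuple, List.map_flatMap, Function.comp_def]

lemma aTuple_length_s9 (ℓ : ℕ) (lam : ℕ → ℕ) (a : ℕ → ℂ) (n : ℕ) :
    (aTuple ℓ lam a n).length = mRem ℓ lam n := by
  have h : (List.range ℓ).drop n = List.range' n (ℓ - n) := by
    simp [List.range_eq_range', List.drop_range']
  simp only [aTuple, mRem, List.length_flatMap, h, List.length_map, List.length_range]
  rfl

lemma mRem_le (d ℓ : ℕ) (lam : ℕ → ℕ) (hpart : IsPartitionOf d ℓ lam) (n : ℕ) (hn : n < ℓ) :
    mRem ℓ lam n + n ≤ d := by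
  obtain ⟨_, _, hpos, _, hsum⟩ := hpart
  have h1 := Finset.sum_range_add_sum_Ico lam hn.le
  have h2 : n ≤ ∑ i ∈ Finset.range n, lam i := by
    calc n = ∑ i ∈ Finset.range n, 1 := by simp
      _ ≤ _ := Finset.sum_le_sum fun i hi => hpos i (by
        have := Finset.mem_range.1 hi; omega)
  unfold mRem
  omega

lemma map_tanIdeal_le (d ℓ : ℕ) (lam : ℕ → ℕ) (hpart : IsPartitionOf d ℓ lam)
    (a : ℕ → ℂ) (b c : ℂ) :
    Ideal.map (phiAff d b c) (tanIdeal d ℓ lam fun j => b * a j + c) ≤ tanIdeal d ℓ lam a := by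
  unfold tanIdeal
  rw [Ideal.map_span, Ideal.span_le]
  rintro _ ⟨_, ⟨n, J, r, hn, hJ, hr1, hr2, rfl⟩, rfl⟩
  have hm := mRem_le d ℓ lam hpart n hn
  have key := congrFun (phi_gSeq d b c J (aTuple ℓ lam a n)) r
  rw [← aTuple_aff, aTuple_length_s9, hJ] at key
  change phiAff d b c (tanGen d ℓ lam (fun j => b * a j + c) n J r) = _ at key
  rw [SetLike.mem_coe, key]
  unfold PhiSeq
  refine Ideal.sum_mem _ fun s hs => ?_
  have hs' : s ≤ r := by simpa [Nat.lt_succ_iff] using hs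
  by_cases hsm : d - n - mRem ℓ lam n < s
  · exact Ideal.mul_mem_left _ _ (Ideal.subset_span ⟨n, J, s, hn, hJ, hsm, by omega, rfl⟩)
  · have e : ((d - n : ℕ) : ℤ) - (mRem ℓ lam n : ℤ) - s = ((d - n - mRem ℓ lam n - s : ℕ) : ℤ) := by
      omega
    rw [e, Ring.choose_natCast, Nat.choose_eq_zero_of_lt (by omega)]
    simp

lemma phiAff_comp (d : ℕ) (b c b' c' : ℂ) (h1 : b * b' = 1) (h2 : b' * c + c' = 0) :
    (phiAff d b c).comp (phiAff d b' c') = AlgHom.id ℂ _ := by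
  apply MvPolynomial.algHom_ext
  intro i
  have h1' : (C b : MvPolynomial (Fin d) ℂ) * C b' = 1 := by rw [← C_mul, h1, C_1]
  have h2' : (C b' : MvPolynomial (Fin d) ℂ) * C c + C c' = 0 := by
    rw [← C_mul, ← C_add, h2, C_0]
  simp [MvPolynomial.algebraMap_eq]
  linear_combination X i * h1' + h2'

/-- for `b ≠ 0` and `ã = b·a + c`, the automorphism `t_k ↦ b·t_k + c` of
`ℂ[t_1,…,t_d]` maps `⟨𝒞^ã_λ⟩` onto `⟨𝒞^a_λ⟩`, and so induces an algebra isomorphism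
`R_ã(λ) ≅ R_a(λ)`. -/
theorem deformed_TGP_shift_scale (d ℓ : ℕ) (lam : ℕ → ℕ) (hpart : IsPartitionOf d ℓ lam)
    (a : ℕ → ℂ) (b c : ℂ) (hb : b ≠ 0) :
    Ideal.map
        (aeval (fun k : Fin d => C b * X k + C c) :
          MvPolynomial (Fin d) ℂ →ₐ[ℂ] MvPolynomial (Fin d) ℂ)
        (tanIdeal d ℓ lam fun j => b * a j + c) = tanIdeal d ℓ lam a ∧
    ∃ e : TGPAlg d ℓ lam (fun j => b * a j + c) ≃ₐ[ℂ] TGPAlg d ℓ lam a,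
      ∀ f : MvPolynomial (Fin d) ℂ,
        e (Ideal.Quotient.mk (tanIdeal d ℓ lam fun j => b * a j + c) f) =
          Ideal.Quotient.mk (tanIdeal d ℓ lam a)
            (aeval (fun k : Fin d => C b * X k + C c) f) := by
  have hc1 : (phiAff d b c).comp (phiAff d b⁻¹ (-(b⁻¹ * c))) = AlgHom.id ℂ _ :=
    phiAff_comp d _ _ _ _ (mul_inv_cancel₀ hb) (by ring)
  have hc2 : (phiAff d b⁻¹ (-(b⁻¹ * c))).comp (phiAff d b c) = AlgHom.id ℂ _ :=
    phiAff_comp d _ _ _ _ (inv_mul_cancel₀ hb) (by field_simp; ring)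
  have hmap : Ideal.map (phiAff d b c) (tanIdeal d ℓ lam fun j => b * a j + c) =
      tanIdeal d ℓ lam a := by
    apply le_antisymm (map_tanIdeal_le d ℓ lam hpart a b c)
    have h := map_tanIdeal_le d ℓ lam hpart (fun j => b * a j + c) b⁻¹ (-(b⁻¹ * c))
    have ha : (fun j => b⁻¹ * (b * a j + c) + -(b⁻¹ * c)) = a := by
      funext j
      field_simp
      ring
    simp only [ha] at h
    intro f hf
    have h3 := Ideal.mem_map_of_mem (phiAff d b c) (h (Ideal.mem_map_of_mem _ hf))
    have h4 : phiAff d b c (phiAff d b⁻¹ (-(b⁻¹ * c)) f) = f := DFunLike.congr_fun hc1 f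
    rwa [h4] at h3
  refine ⟨hmap, ?_⟩
  exact ⟨Ideal.quotientEquivAlg _ _ (AlgEquiv.ofAlgHom _ _ hc1 hc2) hmap.symm, fun f => rfl⟩

end
end

section
/- Let λ and μ be partitions of d with λ ⊴ μ in dominance order (λ_1 + … + λ_k ≤ μ_1 + … + μ_k for all k). Then 𝒞_μ ⊆ 𝒞_λ as sets of polynomials; consequently ⟨𝒞_μ⟩ ⊆ ⟨𝒞_λ⟩ and the identity of ℂ[t_1, …, t_d] induces a surjective ℂ-algebra homomorphism R(μ) → R(λ). -/
open MvPolynomial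

noncomputable section

/-- The set `𝒞_λ` of (undeformed) Tanisaki polynomials. -/
def tanSet (d ℓ : ℕ) (lam : ℕ → ℕ) : Set (MvPolynomial (Fin d) ℂ) :=
  {g | ∃ n J r, n < ℓ ∧ J.card = d - n ∧
    d - n - mRem ℓ lam n < r ∧ r ≤ d - n ∧ g = elemSym d J r}

/-- if `λ ⊴ μ` in dominance order then `𝒞_μ ⊆ 𝒞_λ`, hence `⟨𝒞_μ⟩ ⊆ ⟨𝒞_λ⟩`
and the identity induces a surjective algebra homomorphism `R(μ) → R(λ)`. -/
theorem TGP_dominance (d ℓ₁ ℓ₂ : ℕ) (lam mu : ℕ → ℕ)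
    (hlam : IsPartitionOf d ℓ₁ lam) (hmu : IsPartitionOf d ℓ₂ mu)
    (hdom : ∀ k : ℕ, ∑ i ∈ Finset.range k, lam i ≤ ∑ i ∈ Finset.range k, mu i) :
    tanSet d ℓ₂ mu ⊆ tanSet d ℓ₁ lam ∧
    Ideal.span (tanSet d ℓ₂ mu) ≤ Ideal.span (tanSet d ℓ₁ lam) ∧
    ∃ ψ : (MvPolynomial (Fin d) ℂ ⧸ Ideal.span (tanSet d ℓ₂ mu)) →ₐ[ℂ]
        (MvPolynomial (Fin d) ℂ ⧸ Ideal.span (tanSet d ℓ₁ lam)),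
      Function.Surjective ψ ∧
      ∀ f : MvPolynomial (Fin d) ℂ,
        ψ (Ideal.Quotient.mk (Ideal.span (tanSet d ℓ₂ mu)) f) =
          Ideal.Quotient.mk (Ideal.span (tanSet d ℓ₁ lam)) f := by
  have hl : ℓ₂ ≤ ℓ₁ := by
    by_contra! h
    have h1 := hdom ℓ₁
    obtain ⟨-, -, -, -, hs⟩ := hlam
    obtain ⟨-, -, hp, -, hs2⟩ := hmu
    have h2 : ∑ i ∈ Finset.range (ℓ₁ + 1), mu i ≤ ∑ i ∈ Finset.range ℓ₂, mu i :=
      Finset.sum_le_sum_of_subset (Finset.range_mono h)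
    rw [Finset.sum_range_succ] at h2
    have := hp _ h
    omega
  have hsub : tanSet d ℓ₂ mu ⊆ tanSet d ℓ₁ lam := by
    rintro g ⟨n, J, r, hn, hJ, h1, h2, rfl⟩
    refine ⟨n, J, r, by omega, hJ, ?_, h2, rfl⟩
    have hA : ∑ i ∈ Finset.range n, lam i + mRem ℓ₁ lam n = d := by
      rw [mRem, Finset.sum_range_add_sum_Ico _ (by omega)]
      exact hlam.2.2.2.2
    have hB : ∑ i ∈ Finset.range n, mu i + mRem ℓ₂ mu n = d := by
      rw [mRem, Finset.sum_range_add_sum_Ico _ (by omega)]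
      exact hmu.2.2.2.2
    have := hdom n
    omega
  have hspan := Ideal.span_mono hsub
  refine ⟨hsub, hspan, Ideal.Quotient.factorₐ ℂ hspan, ?_, fun f => rfl⟩
  exact Ideal.Quotient.factor_surjective hspan

end
end
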